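/- arXiv:2003.11886 — 3 statements merged into one kernel-verified Lean document; each statement's English description precedes it below -/
import Mathlib

section
/- Let n ≥ 0, let U ⊆ ℝ^{n+1} be open, let u : U → ℝ be C², and let x ∈ U with ∇u(x) ≠ 0. Set ν(x) = ∇u(x)/|∇u(x)|. Then the function y ↦ |∇u(y)| is differentiable at x with gradient ∇|∇u|(x) = Hess u(x) · ν(x), and the Frobenius norm of the enhanced second fundamental form satisfies the identity |𝒜(u)(x)|² = ( |Hess u(x)|² − |∇|∇u|(x)|² ) / |∇u(x)|², where |Hess u(x)| denotes the Frobenius norm of the Hessian; that is, |𝒜(u)(x)| = √(|∇²u|² − |∇|∇u||²) / |∇u| at x. -/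
open scoped RealInnerProductSpace

section

variable {E F : Type*} [NormedAddCommGroup E] [NormedSpace ℝ E]
  [NormedAddCommGroup F] [InnerProductSpace ℝ F]

/-- The derivative of `‖G‖` away from the zeros of `G` is `v ↦ ⟪G x / ‖G x‖, G' v⟫`. -/
theorem HasFDerivAt.norm_of_ne_zero {G : E → F} {G' : E →L[ℝ] F} {x : E}
    (h : HasFDerivAt G G' x) (hx : G x ≠ 0) :
    HasFDerivAt (fun y => ‖G y‖) ((innerSL ℝ (‖G x‖⁻¹ • G x)).comp G') x := by
  have hn : ‖G x‖ ≠ 0 := norm_ne_zero_iff.mpr hx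
  have h1 := h.norm_sq.sqrt (pow_ne_zero 2 hn)
  simp only [Real.sqrt_sq (norm_nonneg _)] at h1
  refine h1.congr_fderiv ?_
  ext v
  simp
  field_simp

/-- The derivative of the normalized field `G / ‖G‖`, applied to a vector. -/
theorem HasFDerivAt.fderiv_normalize_apply {G : E → F} {G' : E →L[ℝ] F} {x : E}
    (h : HasFDerivAt G G' x) (hx : G x ≠ 0) (v : E) :
    fderiv ℝ (fun y => ‖G y‖⁻¹ • G y) x v =
      ‖G x‖⁻¹ • (G' v - ⟪‖G x‖⁻¹ • G x, G' v⟫ • (‖G x‖⁻¹ • G x)) := by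
  have hn : ‖G x‖ ≠ 0 := norm_ne_zero_iff.mpr hx
  have h1 := ((hasDerivAt_inv hn).comp_hasFDerivAt x (h.norm_of_ne_zero hx)).smul h
  have h2 := h1.fderiv
  simp only [Function.comp_def] at h2
  rw [show (fun y => ‖G y‖⁻¹ • G y) = (fun y => ‖G y‖⁻¹) • G from rfl, h2]
  simp only [add_apply, smul_apply,
    ContinuousLinearMap.smulRight_apply, ContinuousLinearMap.comp_apply, innerSL_apply_apply,
    smul_eq_mul, smul_sub, smul_smul]
  rw [sub_eq_add_neg, ← neg_smul]
  congr 2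
  field_simp

/-- Removing the component along a unit vector: Pythagoras. -/
theorem norm_sub_inner_smul_sq {e w : F} (he : ‖e‖ = 1) :
    ‖w - ⟪e, w⟫ • e‖ ^ 2 = ‖w‖ ^ 2 - ⟪e, w⟫ ^ 2 := by
  rw [norm_sub_sq_real, inner_smul_right, norm_smul, he, real_inner_comm, Real.norm_eq_abs,
    mul_one, sq_abs]
  ring

end

section

variable {E : Type*} [NormedAddCommGroup E] [InnerProductSpace ℝ E] [CompleteSpace E]

theorem ContDiffAt.differentiableAt_gradient {u : E → ℝ} {x : E} (hu : ContDiffAt ℝ 2 u x) :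
    DifferentiableAt ℝ (gradient u) x :=
  (InnerProductSpace.toDual ℝ E).symm.differentiableAt.comp x
    ((hu.fderiv_right (m := 1) (by norm_num)).differentiableAt (by norm_num))

theorem ContDiffAt.inner_fderiv_gradient_comm {u : E → ℝ} {x : E} (hu : ContDiffAt ℝ 2 u x)
    (v w : E) :
    ⟪fderiv ℝ (gradient u) x v, w⟫ = ⟪v, fderiv ℝ (gradient u) x w⟫ := by
  have hd : DifferentiableAt ℝ (fderiv ℝ u) x :=
    (hu.fderiv_right (m := 1) (by norm_num)).differentiableAt (by norm_num)
  have happly (a b : E) : ⟪fderiv ℝ (gradient u) x a, b⟫ = fderiv ℝ (fderiv ℝ u) x a b := by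
    have h : (fun y => ⟪gradient u y, b⟫) = fun y => fderiv ℝ u y b := by
      ext y
      exact InnerProductSpace.toDual_symm_apply
    have h1 := hu.differentiableAt_gradient.hasFDerivAt.inner ℝ (hasFDerivAt_const b x)
    rw [h] at h1
    simpa using congrArg (fun L : E →L[ℝ] ℝ => L a)
      (h1.unique (hd.hasFDerivAt.clm_apply (hasFDerivAt_const b x)))
  rw [happly, real_inner_comm, happly]
  exact hu.isSymmSndFDerivAt (by simp) v w

end


/-- at a point where ∇u ≠ 0, the function |∇u| is differentiable with
gradient Hess u · ν (ν = ∇u/|∇u|), and the squared Frobenius (Hilbert–Schmidt) norm of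
the enhanced second fundamental form 𝒜(u) = D(∇u/|∇u|) satisfies
|𝒜(u)|² = (|Hess u|² - |∇|∇u||²)/|∇u|², Frobenius norms computed in the standard
orthonormal basis. -/
theorem stmt8 (n : ℕ) (U : Set (EuclideanSpace ℝ (Fin (n + 1)))) (hU : IsOpen U)
    (u : EuclideanSpace ℝ (Fin (n + 1)) → ℝ) (hu : ContDiffOn ℝ 2 u U)
    (x : EuclideanSpace ℝ (Fin (n + 1))) (hx : x ∈ U) (hgrad : gradient u x ≠ 0) :
    HasGradientAt (fun y => ‖gradient u y‖)
      (fderiv ℝ (gradient u) x (‖gradient u x‖⁻¹ • gradient u x)) x ∧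
    (∑ i, ‖fderiv ℝ (fun y => ‖gradient u y‖⁻¹ • gradient u y) x
        (EuclideanSpace.single i 1)‖ ^ 2)
      = ((∑ i, ‖fderiv ℝ (gradient u) x (EuclideanSpace.single i 1)‖ ^ 2)
          - ‖fderiv ℝ (gradient u) x (‖gradient u x‖⁻¹ • gradient u x)‖ ^ 2)
        / ‖gradient u x‖ ^ 2 := by
  have hux : ContDiffAt ℝ 2 u x := hu.contDiffAt (hU.mem_nhds hx)
  have hG := hux.differentiableAt_gradient.hasFDerivAt
  have hsymm := hux.inner_fderiv_gradient_comm
  set ν := ‖gradient u x‖⁻¹ • gradient u x with hν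
  have hν1 : ‖ν‖ = 1 := norm_smul_inv_norm (𝕜 := ℝ) hgrad
  constructor
  · rw [hasGradientAt_iff_hasFDerivAt]
    refine (hG.norm_of_ne_zero hgrad).congr_fderiv ?_
    ext v
    simpa [← hν] using (hsymm ν v).symm
  · have hbasis : ‖fderiv ℝ (gradient u) x ν‖ ^ 2 =
        ∑ i, ⟪ν, fderiv ℝ (gradient u) x (EuclideanSpace.single i 1)⟫ ^ 2 := by
      simp [EuclideanSpace.norm_sq_eq, ← hsymm, EuclideanSpace.inner_single_right]
    rw [hbasis, ← Finset.sum_sub_distrib, Finset.sum_div]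
    refine Finset.sum_congr rfl fun i _ => ?_
    rw [hG.fderiv_normalize_apply hgrad, ← hν, norm_smul, mul_pow, norm_sub_inner_smul_sq hν1,
      norm_inv, norm_norm]
    ring
end

section
/- The one-dimensional standing wave in the plane has entropy exactly α: for v : ℝ² → ℝ defined by v(x₁, x₂) = tanh(x₂/√2), one has λ₁(v) = α. In particular, for every y ∈ ℝ², s > 0 and ρ > 0, ∫_{ℝ²} (4πs)^{−1/2} e^{−|x−y|²/(4s)} [ρ|∇v_ρ(x)|²/2 + W(v_ρ(x))/ρ] dx ≤ α, and the supremum of these quantities over all y, s, ρ equals α. -/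
/-- The double-well potential W(u) = (1/4)(1-u²)². -/
noncomputable def W (u : ℝ) : ℝ := (1 - u ^ 2) ^ 2 / 4

/-- The one-dimensional heteroclinic profile g(x) = tanh(x/√2). -/
noncomputable def heteroclinic (x : ℝ) : ℝ := Real.tanh (x / Real.sqrt 2)

/-- α = ∫ g'², the energy of the heteroclinic profile. -/
noncomputable def acEnergy : ℝ := ∫ x : ℝ, (deriv heteroclinic x) ^ 2

/-- The Allen–Cahn entropy λ₁ of v : ℝ² → ℝ (kernel (4πs)^{-1/2}, i.e. n = 1). -/
noncomputable def entropy2 (v : EuclideanSpace ℝ (Fin 2) → ℝ) : ℝ :=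
  sSup {E : ℝ | ∃ (y : EuclideanSpace ℝ (Fin 2)) (s ρ : ℝ), 0 < s ∧ 0 < ρ ∧
    E = ∫ x : EuclideanSpace ℝ (Fin 2),
      (4 * Real.pi * s) ^ (-(1 : ℝ) / 2) * Real.exp (-‖x - y‖ ^ 2 / (4 * s)) *
        (ρ * ‖gradient (fun z => v (ρ⁻¹ • z)) x‖ ^ 2 / 2 + W (v (ρ⁻¹ • x)) / ρ)}

/-- The planar standing wave v(x₁,x₂) = tanh(x₂/√2). -/
noncomputable def planarWave (x : EuclideanSpace ℝ (Fin 2)) : ℝ :=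
  Real.tanh (x 1 / Real.sqrt 2)

/-- The derivative `(1 - tanh²(t/√2)) / √2` of the heteroclinic profile. -/
noncomputable def heteroclinicSlope (t : ℝ) : ℝ := (1 - heteroclinic t ^ 2) / √2

lemma hasDerivAt_heteroclinic (t : ℝ) :
    HasDerivAt heteroclinic (heteroclinicSlope t) t := by
  have hc : Real.cosh (t / √2) ≠ 0 := (Real.cosh_pos _).ne'
  have hlin : HasDerivAt (fun x : ℝ => x / √2) (1 / √2) t := (hasDerivAt_id t).div_const _
  have h := (hlin.sinh.div hlin.cosh hc)
  have heq : heteroclinic = (fun x => Real.sinh (x / √2)) / fun x => Real.cosh (x / √2) := by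
    funext x
    simp [heteroclinic, Real.tanh_eq_sinh_div_cosh]
  rw [heq]
  refine h.congr_deriv ?_
  simp only [heteroclinicSlope, heteroclinic, Real.tanh_eq_sinh_div_cosh]
  field_simp

lemma continuous_heteroclinicSlope : Continuous heteroclinicSlope := by
  have h : Continuous heteroclinic :=
    continuous_iff_continuousAt.2 fun t => (hasDerivAt_heteroclinic t).continuousAt
  unfold heteroclinicSlope
  fun_prop

lemma heteroclinicSlope_sq (t : ℝ) : heteroclinicSlope t ^ 2 = 2 * W (heteroclinic t) := by
  rw [heteroclinicSlope, W, div_pow, Real.sq_sqrt zero_le_two]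
  ring

lemma acEnergy_eq : acEnergy = ∫ t : ℝ, heteroclinicSlope t ^ 2 := by
  simp only [acEnergy, (hasDerivAt_heteroclinic _).deriv]

lemma sq_le_sinh_sq (t : ℝ) : t ^ 2 ≤ Real.sinh t ^ 2 := by
  rw [← sq_abs t, ← sq_abs (Real.sinh t), Real.abs_sinh]
  exact pow_le_pow_left₀ (abs_nonneg t) (Real.self_le_sinh_iff.2 (abs_nonneg t)) 2

lemma integrable_heteroclinicSlope_sq :
    MeasureTheory.Integrable fun t : ℝ => heteroclinicSlope t ^ 2 := by
  have h2 : (√2 : ℝ) ≠ 0 := by positivity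
  refine (integrable_inv_one_add_sq.comp_div h2).mono'
    (continuous_heteroclinicSlope.pow 2).aestronglyMeasurable
    (Filter.Eventually.of_forall fun t => ?_)
  have hc : 0 < Real.cosh (t / √2) := Real.cosh_pos _
  have hs := Real.cosh_sq (t / √2)
  have hle := sq_le_sinh_sq (t / √2)
  have hform : 1 - heteroclinic t ^ 2 = (Real.cosh (t / √2) ^ 2)⁻¹ := by
    rw [heteroclinic, Real.tanh_eq_sinh_div_cosh]
    field_simp
    linarith
  have hone : (Real.cosh (t / √2) ^ 2)⁻¹ ≤ 1 :=
    inv_le_one_of_one_le₀ (by nlinarith [sq_nonneg (Real.sinh (t / √2))])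
  have hinv : (Real.cosh (t / √2) ^ 2)⁻¹ ≤ (1 + (t / √2) ^ 2)⁻¹ :=
    inv_anti₀ (by positivity) (by linarith)
  have hpos : 0 ≤ (Real.cosh (t / √2) ^ 2)⁻¹ := by positivity
  rw [Real.norm_of_nonneg (sq_nonneg _), heteroclinicSlope, hform, div_pow,
    Real.sq_sqrt zero_le_two]
  nlinarith

lemma hasGradientAt_planarWave_smul (c : ℝ) (x : EuclideanSpace ℝ (Fin 2)) :
    HasGradientAt (fun z => planarWave (c • z))
      ((heteroclinicSlope (c * x 1) * c) • EuclideanSpace.single (1 : Fin 2) (1 : ℝ)) x := by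
  rw [hasGradientAt_iff_hasFDerivAt]
  have hproj : HasFDerivAt (fun z : EuclideanSpace ℝ (Fin 2) => c * z 1)
      (c • (EuclideanSpace.proj (1 : Fin 2) : StrongDual ℝ (EuclideanSpace ℝ (Fin 2)))) x :=
    (EuclideanSpace.proj (1 : Fin 2) :
      StrongDual ℝ (EuclideanSpace ℝ (Fin 2))).hasFDerivAt.const_mul c
  have h := (hasDerivAt_heteroclinic (c * x 1)).comp_hasFDerivAt x hproj
  have heq : (fun z => planarWave (c • z)) =
      heteroclinic ∘ fun z : EuclideanSpace ℝ (Fin 2) => c * z 1 := by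
    funext z
    simp [planarWave, heteroclinic]
  rw [heq]
  refine h.congr_fderiv ?_
  ext z
  simp [EuclideanSpace.inner_single_left, mul_assoc]

lemma allenCahnDensity_planarWave {ρ : ℝ} (hρ : 0 < ρ) (x : EuclideanSpace ℝ (Fin 2)) :
    ρ * ‖gradient (fun z => planarWave (ρ⁻¹ • z)) x‖ ^ 2 / 2 + W (planarWave (ρ⁻¹ • x)) / ρ =
      ρ⁻¹ * heteroclinicSlope (ρ⁻¹ * x 1) ^ 2 := by
  have hW : W (planarWave (ρ⁻¹ • x)) = heteroclinicSlope (ρ⁻¹ * x 1) ^ 2 / 2 := by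
    rw [heteroclinicSlope_sq]
    simp [planarWave, heteroclinic]
  rw [hW, (hasGradientAt_planarWave_smul ρ⁻¹ x).gradient, norm_smul, mul_pow,
    PiLp.norm_single, Real.norm_eq_abs, sq_abs, norm_one]
  field_simp
  ring

lemma gaussian_normalization {s : ℝ} (hs : 0 < s) (a : ℝ) :
    ∫ t : ℝ, (4 * Real.pi * s) ^ (-(1 : ℝ) / 2) * Real.exp (-(t - a) ^ 2 / (4 * s)) = 1 := by
  have hpos : 0 < 4 * Real.pi * s := by positivity
  rw [MeasureTheory.integral_const_mul,
    MeasureTheory.integral_sub_right_eq_self (fun t : ℝ => Real.exp (-t ^ 2 / (4 * s))) a]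
  have h := integral_gaussian (1 / (4 * s))
  have hfun : (fun t : ℝ => Real.exp (-t ^ 2 / (4 * s))) =
      fun t : ℝ => Real.exp (-(1 / (4 * s)) * t ^ 2) := by
    funext t
    congr 1
    ring
  rw [hfun, h, Real.sqrt_eq_rpow, show Real.pi / (1 / (4 * s)) = 4 * Real.pi * s by field_simp,
    ← Real.rpow_add hpos]
  norm_num

/-- Integrating out the tangential variable reduces the weighted energy to one dimension. -/
lemma weightedEnergy_planarWave (y : EuclideanSpace ℝ (Fin 2)) {s ρ : ℝ} (hs : 0 < s)
    (hρ : 0 < ρ) :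
    (∫ x : EuclideanSpace ℝ (Fin 2),
      (4 * Real.pi * s) ^ (-(1 : ℝ) / 2) * Real.exp (-‖x - y‖ ^ 2 / (4 * s)) *
        (ρ * ‖gradient (fun z => planarWave (ρ⁻¹ • z)) x‖ ^ 2 / 2
          + W (planarWave (ρ⁻¹ • x)) / ρ)) =
      ∫ t : ℝ, Real.exp (-(ρ * t - y 1) ^ 2 / (4 * s)) * heteroclinicSlope t ^ 2 := by
  let f : Fin 2 → ℝ → ℝ := ![
    fun t => (4 * Real.pi * s) ^ (-(1 : ℝ) / 2) * Real.exp (-(t - y 0) ^ 2 / (4 * s)),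
    fun t => Real.exp (-(t - y 1) ^ 2 / (4 * s)) * (ρ⁻¹ * heteroclinicSlope (ρ⁻¹ * t) ^ 2)]
  rw [← (PiLp.volume_preserving_toLp (Fin 2)).integral_comp
    (MeasurableEquiv.toLp 2 (Fin 2 → ℝ)).measurableEmbedding]
  have hprod : ∀ x : Fin 2 → ℝ,
      (4 * Real.pi * s) ^ (-(1 : ℝ) / 2) * Real.exp (-‖WithLp.toLp 2 x - y‖ ^ 2 / (4 * s)) *
        (ρ * ‖gradient (fun z => planarWave (ρ⁻¹ • z)) (WithLp.toLp 2 x)‖ ^ 2 / 2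
          + W (planarWave (ρ⁻¹ • WithLp.toLp 2 x)) / ρ) = ∏ i, f i (x i) := by
    intro x
    have hexp : -((x 0 - y 0) ^ 2 + (x 1 - y 1) ^ 2) / (4 * s) =
        -(x 0 - y 0) ^ 2 / (4 * s) + -(x 1 - y 1) ^ 2 / (4 * s) := by ring
    rw [allenCahnDensity_planarWave hρ, EuclideanSpace.real_norm_sq_eq]
    simp only [Fin.sum_univ_two, Fin.prod_univ_two, PiLp.sub_apply, f, hexp, Real.exp_add,
      Matrix.cons_val_zero, Matrix.cons_val_one]
    ring
  simp only [hprod]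
  rw [MeasureTheory.integral_fintype_prod_volume_eq_prod, Fin.prod_univ_two]
  simp only [f, Matrix.cons_val_zero, Matrix.cons_val_one]
  rw [gaussian_normalization hs, one_mul]
  have h := MeasureTheory.Measure.integral_comp_mul_left
    (fun t : ℝ => Real.exp (-(ρ * t - y 1) ^ 2 / (4 * s)) * (ρ⁻¹ * heteroclinicSlope t ^ 2)) ρ⁻¹
  simp only [mul_inv_cancel_left₀ hρ.ne', inv_inv, abs_of_pos hρ, smul_eq_mul] at h
  rw [h, ← MeasureTheory.integral_const_mul]
  congr 1
  funext t
  field_simp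

lemma exp_neg_sq_div_le_one (a : ℝ) {s : ℝ} (hs : 0 < s) : Real.exp (-a ^ 2 / (4 * s)) ≤ 1 :=
  Real.exp_le_one_iff.2
    (div_nonpos_of_nonpos_of_nonneg (by nlinarith [sq_nonneg a]) (by positivity))

lemma weightedEnergy_planarWave_le (y : EuclideanSpace ℝ (Fin 2)) {s ρ : ℝ} (hs : 0 < s)
    (hρ : 0 < ρ) :
    (∫ x : EuclideanSpace ℝ (Fin 2),
      (4 * Real.pi * s) ^ (-(1 : ℝ) / 2) * Real.exp (-‖x - y‖ ^ 2 / (4 * s)) *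
        (ρ * ‖gradient (fun z => planarWave (ρ⁻¹ • z)) x‖ ^ 2 / 2
          + W (planarWave (ρ⁻¹ • x)) / ρ)) ≤ acEnergy := by
  rw [weightedEnergy_planarWave y hs hρ, acEnergy_eq]
  refine MeasureTheory.integral_mono_of_nonneg (Filter.Eventually.of_forall fun t => by positivity)
    integrable_heteroclinicSlope_sq (Filter.Eventually.of_forall fun t => ?_)
  exact mul_le_of_le_one_left (sq_nonneg _) (exp_neg_sq_div_le_one _ hs)

/-- Widening Gaussians recover the full energy of the heteroclinic profile. -/
lemma tendsto_gaussian_heteroclinicSlope :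
    Filter.Tendsto
      (fun s : ℝ => ∫ t : ℝ, Real.exp (-t ^ 2 / (4 * s)) * heteroclinicSlope t ^ 2)
      Filter.atTop (nhds acEnergy) := by
  rw [acEnergy_eq]
  refine MeasureTheory.tendsto_integral_filter_of_dominated_convergence
    (fun t => heteroclinicSlope t ^ 2) (Filter.Eventually.of_forall fun s => ?_) ?_
    integrable_heteroclinicSlope_sq (Filter.Eventually.of_forall fun t => ?_)
  · have := continuous_heteroclinicSlope
    exact Continuous.aestronglyMeasurable (by fun_prop)
  · filter_upwards [Filter.eventually_gt_atTop 0] with s hs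
    refine Filter.Eventually.of_forall fun t => ?_
    rw [Real.norm_of_nonneg (by positivity)]
    exact mul_le_of_le_one_left (sq_nonneg _) (exp_neg_sq_div_le_one _ hs)
  · have h0 : Filter.Tendsto (fun s : ℝ => -t ^ 2 / (4 * s)) Filter.atTop (nhds 0) :=
      Filter.Tendsto.const_div_atTop
        (Filter.Tendsto.const_mul_atTop (by norm_num) Filter.tendsto_id) _
    simpa using ((Real.continuous_exp.tendsto 0).comp h0).mul_const (heteroclinicSlope t ^ 2)

/-- the one-dimensional standing wave in the plane has entropy exactly α:
each Gaussian-weighted energy is at most α, and the supremum over all centres, scales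
and dilations equals α. -/
theorem stmt15 :
    (∀ (y : EuclideanSpace ℝ (Fin 2)) (s ρ : ℝ), 0 < s → 0 < ρ →
      (∫ x : EuclideanSpace ℝ (Fin 2),
        (4 * Real.pi * s) ^ (-(1 : ℝ) / 2) * Real.exp (-‖x - y‖ ^ 2 / (4 * s)) *
          (ρ * ‖gradient (fun z => planarWave (ρ⁻¹ • z)) x‖ ^ 2 / 2
            + W (planarWave (ρ⁻¹ • x)) / ρ)) ≤ acEnergy) ∧
    entropy2 planarWave = acEnergy := by
  refine ⟨fun y s ρ hs hρ => weightedEnergy_planarWave_le y hs hρ, ?_⟩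
  refine IsLUB.csSup_eq ⟨?_, fun b hb => ?_⟩ ⟨_, 0, 1, 1, one_pos, one_pos, rfl⟩
  · rintro E ⟨y, s, ρ, hs, hρ, rfl⟩
    exact weightedEnergy_planarWave_le y hs hρ
  · refine le_of_tendsto tendsto_gaussian_heteroclinicSlope ?_
    filter_upwards [Filter.eventually_gt_atTop 0] with s hs
    refine hb ⟨0, s, 1, hs, one_pos, ?_⟩
    rw [weightedEnergy_planarWave 0 hs one_pos]
    simp
end

section
/- (Cutoff approximation of the heteroclinic.) Let ζ : ℝ → ℝ be smooth with 0 ≤ ζ ≤ 1, ζ ≡ 1 on [−1, 1], support of ζ contained in (−2, 2), and |ζ'| + |ζ''| ≤ 16. There exists a constant C > 0 such that for every ε ∈ (0, 1/2), setting L = 3|log ε| and defining ḡ : ℝ → ℝ by ḡ(x) = ζ(x/L) g(x) + (1 − ζ(x/L)) sgn(x), the function ḡ is smooth and, with η̄ := ḡ'' − W'(ḡ): (i) η̄ is supported in {x : L ≤ |x| ≤ 2L}; (ii) |η̄(x)| ≤ C ε³ for all x; and (iii) |∫_ℝ ḡ'(x)² dx − α| ≤ C ε³. -/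
/-- W'(u) = u³ - u. -/
noncomputable def W' (u : ℝ) : ℝ := u ^ 3 - u

open Filter Topology MeasureTheory

theorem contDiff_heteroclinic {n : WithTop ℕ∞} : ContDiff ℝ n heteroclinic := by
  have h : heteroclinic = fun x => Real.sinh (x / √2) / Real.cosh (x / √2) := by
    ext x
    rw [heteroclinic, Real.tanh_eq_sinh_div_cosh]
  rw [h]
  exact (Real.contDiff_sinh.comp (contDiff_id.div_const _)).div
    (Real.contDiff_cosh.comp (contDiff_id.div_const _)) fun x => (Real.cosh_pos _).ne'

theorem hasDerivAt_heteroclinic_s16 (x : ℝ) :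
    HasDerivAt heteroclinic ((1 - heteroclinic x ^ 2) / √2) x := by
  have h : heteroclinic = fun x => Real.sinh (x / √2) / Real.cosh (x / √2) := by
    ext x
    rw [heteroclinic, Real.tanh_eq_sinh_div_cosh]
  have hc := (Real.cosh_pos (x / √2)).ne'
  have hd := (hasDerivAt_id x).div_const √2
  rw [h]
  refine (hd.sinh.div hd.cosh hc).congr_deriv ?_
  simp only [id]
  field_simp

theorem deriv_heteroclinic :
    deriv heteroclinic = fun x => (1 - heteroclinic x ^ 2) / √2 :=
  funext fun x => (hasDerivAt_heteroclinic_s16 x).deriv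

theorem hasDerivAt_deriv_heteroclinic (x : ℝ) :
    HasDerivAt (deriv heteroclinic) (W' (heteroclinic x)) x := by
  rw [deriv_heteroclinic]
  refine ((((hasDerivAt_heteroclinic_s16 x).pow 2).const_sub 1).div_const √2).congr_deriv ?_
  have h2 : √2 ^ 2 = (2 : ℝ) := Real.sq_sqrt (by norm_num)
  rw [W']
  field_simp
  rw [h2]
  push_cast
  ring

theorem abs_heteroclinic_lt_one (x : ℝ) : |heteroclinic x| < 1 :=
  abs_lt.2 ⟨Real.neg_one_lt_tanh _, Real.tanh_lt_one _⟩

theorem one_sub_heteroclinic_le (x : ℝ) : 1 - heteroclinic x ≤ 2 * Real.exp (-(√2 * x)) := by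
  have h2 : √2 * √2 = (2 : ℝ) := Real.mul_self_sqrt (by norm_num)
  have hy : √2 * x = x / √2 + x / √2 := by
    field_simp
    linear_combination x * h2
  rw [heteroclinic, Real.tanh_eq_sinh_div_cosh, Real.sinh_eq, Real.cosh_eq, hy, neg_add,
    Real.exp_add]
  set y := x / √2
  have hp := Real.exp_pos y
  have hn := Real.exp_pos (-y)
  have hm : Real.exp y * Real.exp (-y) = 1 := by rw [← Real.exp_add]; simp
  have he : 1 - (Real.exp y - Real.exp (-y)) / 2 / ((Real.exp y + Real.exp (-y)) / 2)
      = 2 * Real.exp (-y) / (Real.exp y + Real.exp (-y)) := by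
    field_simp
    ring
  rw [he, div_le_iff₀ (by positivity)]
  have h3 : 0 < Real.exp (-y) * Real.exp (-y) * Real.exp (-y) := by positivity
  have h4 : Real.exp (-y) * Real.exp (-y) * Real.exp y = Real.exp (-y) := by
    linear_combination Real.exp (-y) * hm
  linarith

theorem heteroclinic_neg (x : ℝ) : heteroclinic (-x) = -heteroclinic x := by
  simp [heteroclinic, neg_div]

/-- The heteroclinic converges exponentially to the constant phases `±1`. -/
theorem exists_phase_abs_heteroclinic_sub_le (x : ℝ) :
    ∃ s : ℝ, s ^ 2 = 1 ∧ |heteroclinic x - s| ≤ 2 * Real.exp (-|x|) ∧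
      (x ≠ 0 → ∀ᶠ y in 𝓝 x, Real.sign y = s) := by
  have hexp : ∀ t : ℝ, 0 ≤ t → 2 * Real.exp (-(√2 * t)) ≤ 2 * Real.exp (-t) := fun t ht => by
    have h1 : (1 : ℝ) ≤ √2 := Real.one_le_sqrt.2 (by norm_num)
    gcongr
    nlinarith
  rcases le_or_gt 0 x with hx | hx
  · refine ⟨1, by norm_num, ?_, fun h0 => ?_⟩
    · rw [abs_of_nonneg hx, abs_of_neg (sub_neg.2 (abs_lt.1 (abs_heteroclinic_lt_one x)).2),
        neg_sub]
      exact (one_sub_heteroclinic_le x).trans (hexp x hx)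
    · filter_upwards [lt_mem_nhds (lt_of_le_of_ne hx h0.symm)] with y hy
      exact Real.sign_of_pos hy
  · refine ⟨-1, by norm_num, ?_, fun _ => ?_⟩
    · have h := (one_sub_heteroclinic_le (-x)).trans (hexp (-x) (by linarith))
      rw [heteroclinic_neg] at h
      have h1 := (abs_lt.1 (abs_heteroclinic_lt_one x)).1
      rw [abs_of_neg hx, abs_of_pos (by linarith)]
      linarith
    · filter_upwards [gt_mem_nhds hx] with y hy
      exact Real.sign_of_neg hy

/-- If `s = ±1` and `u ∈ [-1, 1]` then `1 - u²` vanishes to first order at `u = s`. -/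
theorem abs_one_sub_sq_le {s u : ℝ} (hs : s ^ 2 = 1) (hu : |u| ≤ 1) :
    |1 - u ^ 2| ≤ 2 * |u - s| := by
  have hs1 : |s| = 1 := by
    rw [← abs_one, ← sq_eq_sq_iff_abs_eq_abs]; linarith
  have h : 1 - u ^ 2 = -((u + s) * (u - s)) := by linear_combination -hs
  rw [h, abs_neg, abs_mul]
  gcongr
  exact (abs_add_le u s).trans (by linarith)

theorem abs_W'_le {s u : ℝ} (hs : s ^ 2 = 1) (hu : |u| ≤ 1) : |W' u| ≤ 2 * |u - s| := by
  have h : W' u = -(u * (1 - u ^ 2)) := by rw [W']; ring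
  rw [h, abs_neg, abs_mul]
  exact (mul_le_of_le_one_left (abs_nonneg _) hu).trans (abs_one_sub_sq_le hs hu)

theorem abs_deriv_heteroclinic_le {s x : ℝ} (hs : s ^ 2 = 1) :
    |deriv heteroclinic x| ≤ 2 * |heteroclinic x - s| := by
  rw [deriv_heteroclinic]
  simp only [abs_div, abs_of_nonneg (Real.sqrt_nonneg 2)]
  exact (div_le_self (abs_nonneg _) (Real.one_le_sqrt.2 (by norm_num))).trans
    (abs_one_sub_sq_le hs (abs_heteroclinic_lt_one x).le)

theorem integrable_exp_neg_abs : Integrable fun x : ℝ => Real.exp (-|x|) := by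
  rw [← integrableOn_univ, ← Set.Iic_union_Ioi (a := (0 : ℝ))]
  refine IntegrableOn.union ?_ ?_
  · refine (integrableOn_exp_Iic 0).congr_fun (fun x hx => ?_) measurableSet_Iic
    simp only [abs_of_nonpos (Set.mem_Iic.1 hx), neg_neg]
  · refine (integrableOn_exp_neg_Ioi 0).congr_fun (fun x hx => ?_) measurableSet_Ioi
    simp only [abs_of_pos (Set.mem_Ioi.1 hx)]

theorem integrable_sq_of_abs_le_exp_neg_abs {f : ℝ → ℝ} {A : ℝ} (hf : Continuous f)
    (h : ∀ x, |f x| ≤ A * Real.exp (-|x|)) : Integrable fun x => f x ^ 2 := by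
  refine (integrable_exp_neg_abs.const_mul (A ^ 2)).mono' (hf.pow 2).aestronglyMeasurable
    (Eventually.of_forall fun x => ?_)
  rw [Real.norm_eq_abs, abs_pow]
  have h1 : Real.exp (-|x|) ≤ 1 := Real.exp_le_one_iff.2 (by simp)
  have h0 := Real.exp_pos (-|x|)
  calc |f x| ^ 2 ≤ (A * Real.exp (-|x|)) ^ 2 := by gcongr; exact h x
    _ = A ^ 2 * (Real.exp (-|x|) * Real.exp (-|x|)) := by ring
    _ ≤ A ^ 2 * Real.exp (-|x|) := by
      gcongr
      exact mul_le_of_le_one_left h0.le h1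

section Cutoff

variable {ζ : ℝ → ℝ} {L s : ℝ}

theorem hasDerivAt_cutoff (hζ : Differentiable ℝ ζ) (x : ℝ) :
    HasDerivAt (fun y => ζ (y / L) * (heteroclinic y - s) + s)
      (deriv ζ (x / L) / L * (heteroclinic x - s) + ζ (x / L) * deriv heteroclinic x) x := by
  have h1 : HasDerivAt (fun y => ζ (y / L)) (deriv ζ (x / L) * (1 / L)) x :=
    (hζ (x / L)).hasDerivAt.comp x ((hasDerivAt_id x).div_const L)
  refine ((h1.mul ((hasDerivAt_heteroclinic_s16 x).sub_const s)).add_const s).congr_deriv ?_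
  rw [deriv_heteroclinic]
  ring

theorem hasDerivAt_deriv_cutoff (hζ : Differentiable ℝ ζ) (hζ' : Differentiable ℝ (deriv ζ))
    (x : ℝ) :
    HasDerivAt
      (fun y => deriv ζ (y / L) / L * (heteroclinic y - s) + ζ (y / L) * deriv heteroclinic y)
      (deriv (deriv ζ) (x / L) / L ^ 2 * (heteroclinic x - s)
        + 2 * (deriv ζ (x / L) / L * deriv heteroclinic x)
        + ζ (x / L) * W' (heteroclinic x)) x := by
  have h1 : HasDerivAt (fun y => ζ (y / L)) (deriv ζ (x / L) * (1 / L)) x :=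
    (hζ (x / L)).hasDerivAt.comp x ((hasDerivAt_id x).div_const L)
  have h2 : HasDerivAt (fun y => deriv ζ (y / L)) (deriv (deriv ζ) (x / L) * (1 / L)) x :=
    HasDerivAt.comp (h₂ := deriv ζ) x (hζ' (x / L)).hasDerivAt ((hasDerivAt_id x).div_const L)
  refine (((h2.div_const L).mul ((hasDerivAt_heteroclinic_s16 x).sub_const s)).add
    (h1.mul (hasDerivAt_deriv_heteroclinic x))).congr_deriv ?_
  rw [deriv_heteroclinic]
  ring

end Cutoff

/-- cutoff approximation of the heteroclinic: given a smooth cutoff ζ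
with 0 ≤ ζ ≤ 1, ζ ≡ 1 on [-1,1], supp ζ ⊆ (-2,2), |ζ'| + |ζ''| ≤ 16, there is C > 0
such that for every ε ∈ (0, 1/2), with L = 3|log ε| and
ḡ(x) = ζ(x/L) g(x) + (1 - ζ(x/L)) sgn(x), the function ḡ is smooth,
η̄ := ḡ'' - W'(ḡ) is supported in {L ≤ |x| ≤ 2L}, |η̄| ≤ C ε³, and |∫ ḡ'² - α| ≤ C ε³. -/
theorem stmt16 (ζ : ℝ → ℝ) (hζs : ContDiff ℝ (⊤ : ℕ∞) ζ)
    (hζ01 : ∀ x, ζ x ∈ Set.Icc (0 : ℝ) 1)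
    (hζ1 : ∀ x ∈ Set.Icc (-1 : ℝ) 1, ζ x = 1)
    (hζsupp : Function.support ζ ⊆ Set.Ioo (-2 : ℝ) 2)
    (hζder : ∀ x, |deriv ζ x| + |deriv (deriv ζ) x| ≤ 16) :
    ∃ C : ℝ, 0 < C ∧
      ∀ ε ∈ Set.Ioo (0 : ℝ) (1 / 2), ∀ L : ℝ, L = 3 * |Real.log ε| →
      ∀ gbar : ℝ → ℝ,
        (∀ x, gbar x = ζ (x / L) * heteroclinic x + (1 - ζ (x / L)) * Real.sign x) →
        ContDiff ℝ (⊤ : ℕ∞) gbar ∧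
        Function.support (fun x => deriv (deriv gbar) x - W' (gbar x))
          ⊆ {x : ℝ | L ≤ |x| ∧ |x| ≤ 2 * L} ∧
        (∀ x, |deriv (deriv gbar) x - W' (gbar x)| ≤ C * ε ^ 3) ∧
        |(∫ x : ℝ, (deriv gbar x) ^ 2) - acEnergy| ≤ C * ε ^ 3 := by
  set I : ℝ := ∫ x : ℝ, Real.exp (-|x|) with hI
  have hI0 : 0 ≤ I := integral_nonneg fun x => (Real.exp_pos _).le
  refine ⟨168 + 1312 * I, by positivity, ?_⟩
  rintro ε ⟨hε0, hε1⟩ L hL gbar hg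
  have hlog : Real.log ε < -(1 / 3) := by
    have h1 : Real.log ε < Real.log (1 / 2) := Real.log_lt_log hε0 hε1
    rw [one_div, Real.log_inv] at h1
    linarith [Real.log_two_gt_d9]
  rw [abs_of_neg (by linarith)] at hL
  have hL1 : 1 ≤ L := by linarith
  have hL0 : 0 < L := by linarith
  have hexpL : Real.exp (-L) = ε ^ 3 := by
    rw [hL, show -(3 * -Real.log ε) = ((3 : ℕ) : ℝ) * Real.log ε by push_cast; ring,
      Real.exp_nat_mul, Real.exp_log hε0]
  have hζd : Differentiable ℝ ζ := hζs.differentiable (by simp)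
  have hζd' : Differentiable ℝ (deriv ζ) :=
    ((contDiff_infty_iff_deriv.1 hζs).2).differentiable (by simp)
  have hD1 : ∀ x, |deriv ζ x| ≤ 16 := fun x => by
    linarith [hζder x, abs_nonneg (deriv (deriv ζ) x)]
  have hD2 : ∀ x, |deriv (deriv ζ) x| ≤ 16 := fun x => by
    linarith [hζder x, abs_nonneg (deriv ζ x)]
  have hζabs : ∀ x, |ζ x| ≤ 1 := fun x => by
    rw [abs_of_nonneg (hζ01 x).1]; exact (hζ01 x).2
  have hin : ∀ x, |x| < L → gbar =ᶠ[𝓝 x] heteroclinic := fun x hx => by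
    filter_upwards [continuous_abs.continuousAt.eventually_lt continuousAt_const hx] with y hy
    have h1 : ζ (y / L) = 1 := hζ1 _ (abs_le.1 (by
      rw [abs_div, abs_of_pos hL0, div_le_one hL0]; exact hy.le))
    rw [hg, h1]
    ring
  have hout : ∀ x s : ℝ, (∀ᶠ y in 𝓝 x, Real.sign y = s) →
      gbar =ᶠ[𝓝 x] fun y => ζ (y / L) * (heteroclinic y - s) + s := fun x s hs => by
    filter_upwards [hs] with y hy
    rw [hg, hy]
    ring
  have hfar : ∀ x s : ℝ, (∀ᶠ y in 𝓝 x, Real.sign y = s) → 2 * L < |x| →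
      gbar =ᶠ[𝓝 x] fun _ => s := fun x s hs hx => by
    filter_upwards [hs, continuousAt_const.eventually_lt continuous_abs.continuousAt hx]
      with y hy hy2
    have h1 : ζ (y / L) = 0 := by
      by_contra h
      have h2 : |y / L| < 2 := abs_lt.2 (hζsupp h)
      rw [abs_div, abs_of_pos hL0, div_lt_iff₀ hL0] at h2
      exact absurd h2 hy2.le.not_gt
    rw [hg, hy, h1]
    ring
  have hne : ∀ x : ℝ, L ≤ |x| → x ≠ 0 := fun x hx => abs_pos.1 (hL0.trans_le hx)
  have hsmooth : ContDiff ℝ (⊤ : ℕ∞) gbar := by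
    refine contDiff_iff_contDiffAt.2 fun x => ?_
    rcases lt_or_ge |x| L with hx | hx
    · exact contDiff_heteroclinic.contDiffAt.congr_of_eventuallyEq (hin x hx)
    · obtain ⟨s, -, -, hs⟩ := exists_phase_abs_heteroclinic_sub_le x
      refine ContDiffAt.congr_of_eventuallyEq (ContDiff.contDiffAt ?_) (hout x s (hs (hne x hx)))
      exact ((hζs.comp (contDiff_id.div_const L)).mul
        (contDiff_heteroclinic.sub contDiff_const)).add contDiff_const
  have hηin : ∀ x, |x| < L → deriv (deriv gbar) x - W' (gbar x) = 0 := fun x hx => by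
    rw [(hin x hx).deriv.deriv_eq, (hin x hx).eq_of_nhds,
      (hasDerivAt_deriv_heteroclinic x).deriv, sub_self]
  have hexp : ∀ x, L ≤ |x| → Real.exp (-|x|) ≤ ε ^ 3 := fun x hx => by
    rw [← hexpL]
    exact Real.exp_le_exp.2 (by linarith)
  have hg' : ∀ x, |deriv heteroclinic x| ≤ 4 * Real.exp (-|x|) := fun x => by
    obtain ⟨s, hs1, hd, -⟩ := exists_phase_abs_heteroclinic_sub_le x
    linarith [abs_deriv_heteroclinic_le (x := x) hs1]
  have hdiv : ∀ a : ℝ, |a| ≤ 16 → |a / L| ≤ 16 := fun a ha => by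
    rw [abs_div, abs_of_pos hL0]
    exact (div_le_self (abs_nonneg _) hL1).trans ha
  have hgbar' : ∀ x, |deriv gbar x| ≤ 36 * Real.exp (-|x|) := fun x => by
    rcases lt_or_ge |x| L with hx | hx
    · rw [(hin x hx).deriv_eq]
      linarith [hg' x, Real.exp_pos (-|x|)]
    · obtain ⟨s, hs1, hd, hs⟩ := exists_phase_abs_heteroclinic_sub_le x
      rw [(hout x s (hs (hne x hx))).deriv_eq, (hasDerivAt_cutoff hζd x).deriv]
      calc _ ≤ |deriv ζ (x / L) / L| * |heteroclinic x - s|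
            + |ζ (x / L)| * |deriv heteroclinic x| := by
            rw [← abs_mul, ← abs_mul]; exact abs_add_le _ _
        _ ≤ 16 * (2 * Real.exp (-|x|)) + 1 * (4 * Real.exp (-|x|)) := by
            gcongr
            exacts [hdiv _ (hD1 _), hζabs _, hg' x]
        _ = 36 * Real.exp (-|x|) := by ring
  refine ⟨hsmooth, fun x hx => ⟨?_, ?_⟩, fun x => ?_, ?_⟩
  · by_contra! h
    exact hx (hηin x h)
  · by_contra! h
    obtain ⟨s, hs1, -, hs⟩ := exists_phase_abs_heteroclinic_sub_le x
    have hf := hfar x s (hs (hne x (by linarith))) h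
    refine hx ?_
    simp only [hf.deriv.deriv_eq, hf.eq_of_nhds, deriv_const', deriv_const, W']
    linear_combination -s * hs1
  · rcases lt_or_ge |x| L with hx | hx
    · rw [hηin x hx, abs_zero]
      positivity
    · obtain ⟨s, hs1, hd, hs⟩ := exists_phase_abs_heteroclinic_sub_le x
      have ho := hout x s (hs (hne x hx))
      have hd3 : |heteroclinic x - s| ≤ 2 * ε ^ 3 := by linarith [hexp x hx]
      have hgs : gbar x - s = ζ (x / L) * (heteroclinic x - s) := by
        rw [ho.eq_of_nhds]; ring
      have hgb : |gbar x| ≤ 1 := by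
        have hg1 := abs_le.1 (abs_heteroclinic_lt_one x).le
        obtain ⟨hz0, hz1⟩ := hζ01 (x / L)
        rw [ho.eq_of_nhds, abs_le]
        rcases (mul_self_eq_one_iff.1 ((sq s).symm.trans hs1)) with rfl | rfl <;> constructor <;> nlinarith
      have hW1 := (abs_W'_le hs1 (abs_heteroclinic_lt_one x).le)
      have hW2 := (abs_W'_le hs1 hgb)
      rw [hgs, abs_mul] at hW2
      have hW3 : |ζ (x / L)| * |heteroclinic x - s| ≤ 1 * (2 * ε ^ 3) := by
        gcongr
        exact hζabs _
      have hderiv : deriv gbar =ᶠ[𝓝 x] fun y =>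
          deriv ζ (y / L) / L * (heteroclinic y - s) + ζ (y / L) * deriv heteroclinic y := by
        refine ho.deriv.trans (Eventually.of_forall fun y => ?_)
        exact (hasDerivAt_cutoff hζd y).deriv
      rw [hderiv.deriv_eq, (hasDerivAt_deriv_cutoff hζd hζd' x).deriv]
      have h1 : |deriv (deriv ζ) (x / L) / L ^ 2 * (heteroclinic x - s)|
          ≤ 16 * (2 * ε ^ 3) := by
        rw [abs_mul, sq, ← div_div]
        gcongr
        exact hdiv _ (hdiv _ (hD2 _))
      have h2 : |deriv ζ (x / L) / L * deriv heteroclinic x| ≤ 16 * (4 * ε ^ 3) := by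
        rw [abs_mul]
        gcongr
        exacts [hdiv _ (hD1 _), (hg' x).trans (by linarith [hexp x hx])]
      have h3 : |ζ (x / L) * W' (heteroclinic x)| ≤ 1 * (4 * ε ^ 3) := by
        rw [abs_mul]
        gcongr
        exacts [hζabs _, hW1.trans (by linarith)]
      have h4 : |W' (gbar x)| ≤ 4 * ε ^ 3 := by linarith
      have h5 : 0 ≤ I * ε ^ 3 := by positivity
      rw [abs_le] at h1 h2 h3 h4 ⊢
      constructor <;> linarith
  · have hi1 : Integrable fun x => deriv gbar x ^ 2 :=
      integrable_sq_of_abs_le_exp_neg_abs (hsmooth.continuous_deriv (by simp)) hgbar'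
    have hi2 : Integrable fun x => deriv heteroclinic x ^ 2 :=
      integrable_sq_of_abs_le_exp_neg_abs
        ((contDiff_heteroclinic (n := 1)).continuous_deriv le_rfl) hg'
    rw [acEnergy, ← integral_sub hi1 hi2, ← Real.norm_eq_abs]
    have hbound : ∀ x, ‖deriv gbar x ^ 2 - deriv heteroclinic x ^ 2‖
        ≤ 1312 * ε ^ 3 * Real.exp (-|x|) := fun x => by
      have he := Real.exp_pos (-|x|)
      rcases lt_or_ge |x| L with hx | hx
      · rw [(hin x hx).deriv_eq, sub_self, norm_zero]
        positivity
      · have h1 := pow_le_pow_left₀ (abs_nonneg _) (hgbar' x) 2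
        have h2 := pow_le_pow_left₀ (abs_nonneg _) (hg' x) 2
        rw [sq_abs] at h1 h2
        have h3 := mul_le_mul_of_nonneg_right (hexp x hx) he.le
        rw [Real.norm_eq_abs, abs_le]
        constructor <;>
          nlinarith [sq_nonneg (deriv gbar x), sq_nonneg (deriv heteroclinic x)]
    calc _ ≤ ∫ x : ℝ, 1312 * ε ^ 3 * Real.exp (-|x|) :=
          norm_integral_le_of_norm_le (integrable_exp_neg_abs.const_mul _)
            (Eventually.of_forall hbound)
      _ = 1312 * ε ^ 3 * I := integral_const_mul _ _
      _ ≤ (168 + 1312 * I) * ε ^ 3 := by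
          have := pow_pos hε0 3
          linarith
end
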